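/- Let n ≥ 4 be an integer, r₁, r₂ ≥ 1 integers with r₁ + r₂ = n − 1, and fix real constants C₁ ≠ 0, C₂, C₃ and μ₁. Suppose a smooth function f on an open interval I ⊆ ℝ satisfies equations (E1) and (E2) at every point of I and f'(s) ≠ 0 for all s ∈ I. Then for all s ∈ I: ((n − 2)·f'(s)² − (n − 1)·(r₁ − 1)·f''(s))·f'(s)·f'''(s) = (C₁²·μ₁ − (r₁ − 1)·f''(s)²)·((n − 1)·f''(s) − f'(s)²). -/

import Mathlib

/-- Under (E1), (E2) and f' ≠ 0 on I, equation (wttLamb_1) holds: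
((n−2)f'² − (n−1)(r₁−1)f'')·f'·f''' = (C₁²μ₁ − (r₁−1)f''²)·((n−1)f'' − f'²). -/
theorem stmt_3 (n r₁ r₂ : ℕ) (hn : 4 ≤ n) (hr₁ : 1 ≤ r₁) (hr₂ : 1 ≤ r₂)
    (hsum : r₁ + r₂ = n - 1)
    (C₁ C₂ C₃ μ₁ : ℝ) (hC₁ : C₁ ≠ 0)
    (a b : ℝ) (hab : a < b) (f : ℝ → ℝ)
    (hf : ContDiffOn ℝ (⊤ : ℕ∞) f (Set.Ioo a b))
    (hf' : ∀ s ∈ Set.Ioo a b, deriv f s ≠ 0)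
    (hE1 : ∀ s ∈ Set.Ioo a b,
      ((n : ℝ) - 1) * deriv (deriv (deriv f)) s
          * (C₁ * C₃ * Real.exp ((f s - C₂) / ((n : ℝ) - 1)) - ((n : ℝ) - 1))
        = ((n : ℝ) - 1) * deriv f s * deriv (deriv f) s - (deriv f s) ^ 3)
    (hE2 : ∀ s ∈ Set.Ioo a b,
      (((n : ℝ) - 2) * deriv f s * deriv (deriv (deriv f)) s
          - ((r₁ : ℝ) - 1) * (deriv (deriv f) s) ^ 2 + C₁ ^ 2 * μ₁)
          * (C₁ * C₃ * Real.exp ((f s - C₂) / ((n : ℝ) - 1)) - ((n : ℝ) - 1))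
        = (r₂ : ℝ) * (deriv f s) ^ 2 * deriv (deriv f) s) :
    ∀ s ∈ Set.Ioo a b,
      (((n : ℝ) - 2) * (deriv f s) ^ 2
          - ((n : ℝ) - 1) * ((r₁ : ℝ) - 1) * deriv (deriv f) s)
          * deriv f s * deriv (deriv (deriv f)) s
        = (C₁ ^ 2 * μ₁ - ((r₁ : ℝ) - 1) * (deriv (deriv f) s) ^ 2)
          * (((n : ℝ) - 1) * deriv (deriv f) s - (deriv f s) ^ 2) := by
  intro s hs
  have h1 := hE1 s hs
  have h2 := hE2 s hs
  have hp := hf' s hs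
  have hr : (r₂ : ℝ) = (n : ℝ) - 1 - r₁ := by
    have h : r₁ + r₂ + 1 = n := by omega
    have h' : (r₁ : ℝ) + r₂ + 1 = n := by exact_mod_cast h
    linarith
  rw [hr] at h2
  generalize C₁ * C₃ * Real.exp ((f s - C₂) / ((n : ℝ) - 1)) - ((n : ℝ) - 1) = L at h1 h2
  generalize deriv (deriv (deriv f)) s = t at *
  generalize deriv (deriv f) s = q at *
  generalize deriv f s = p at *
  apply mul_left_cancel₀ hp
  linear_combination (((n : ℝ) - 2) * p * t - ((r₁ : ℝ) - 1) * q ^ 2 + C₁ ^ 2 * μ₁) * h1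
    - ((n : ℝ) - 1) * t * h2
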